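/- Let ε > 0, 0 < μ ≤ 12. Let u be a classical 1-periodic solution of the quasi-linear surface wave equation on [0,T) with initial data u₀ = u(·,0) ≢ 0, such that ∫₀¹ (u(x,t)² + (μ/12)·u_x(x,t)²) dx = C₀ for every t ∈ [0,T). Set S(0) = sup_{x∈[0,1]} u₀'(x) and suppose ε·S(0)² ≥ (12/μ)·K₁, where K₁ = [2·n₂·C₀^{1/2} + (5/2)·ε·n_∞·C₀ + (1/8)·ε²·n_∞·√(13/μ)·C₀^{3/2} + (3/64)·ε³·n_∞·(13/μ)·C₀² + (7/4)·ε·n_∞·C₀] + [2·√(13/μ)·C₀^{1/2} + (5/2)·ε·(13/μ)·C₀ + (1/8)·ε²·(13/μ)^{3/2}·C₀^{3/2} + (3/64)·ε³·(13/μ)²·C₀²], with n₂ = ‖P‖_{L²[0,1]} and n_∞ = ‖P‖_{L^∞[0,1]}. Then T ≤ 4/(3·ε·S(0)); in particular, no such solution exists on a time interval of length greater than 4/(3·ε·S(0)), so wave breaking occurs in finite time of order O(1/ε). -/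

import Mathlib

/-- The 1-periodic Green's function of the operator `1 - (μ/12)∂ₓ²`. -/
noncomputable def P (μ x : ℝ) : ℝ :=
  Real.sqrt (3/μ) *
    (Real.exp (2 * Real.sqrt (3/μ) * (x - ⌊x⌋)) +
     Real.exp (2 * Real.sqrt (3/μ) * (1 - (x - ⌊x⌋)))) /
  (Real.exp (2 * Real.sqrt (3/μ)) - 1)

/-- Periodic convolution with the kernel `P` over one period. -/
noncomputable def pconv (μ : ℝ) (h : ℝ → ℝ) (x : ℝ) : ℝ :=
  ∫ y in (0:ℝ)..1, P μ (x - y) * h y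

/-- The nonlinearity `g(w) = 2w + (5/2)εw² - (1/8)ε²w³ + (3/64)ε³w⁴ - (7/48)εμ(wₓ)²`,
with the derivative `w'` supplied explicitly. -/
noncomputable def gfun (ε μ : ℝ) (w w' : ℝ → ℝ) (x : ℝ) : ℝ :=
  2 * w x + (5/2) * ε * (w x)^2 - (1/8) * ε^2 * (w x)^3 + (3/64) * ε^3 * (w x)^4
    - (7/48) * ε * μ * (w' x)^2

/-- A classical 1-periodic solution of the quasi-linear surface wave equation
`u_t - u_x - (7/2)ε u u_x + ∂ₓ(P∗g(u)) = 0` on `ℝ × [0,T)`, recorded together with the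
partial derivatives `u_x`, `u_{xx}`, `u_t`, `u_{tx}`. -/
structure QLSol (ε μ T : ℝ) where
  u : ℝ → ℝ → ℝ
  ux : ℝ → ℝ → ℝ
  uxx : ℝ → ℝ → ℝ
  ut : ℝ → ℝ → ℝ
  utx : ℝ → ℝ → ℝ
  periodic : ∀ t ∈ Set.Ico (0:ℝ) T, Function.Periodic (fun x => u x t) 1
  hux : ∀ (x : ℝ), ∀ t ∈ Set.Ico (0:ℝ) T, HasDerivAt (fun x' => u x' t) (ux x t) x
  huxx : ∀ (x : ℝ), ∀ t ∈ Set.Ico (0:ℝ) T, HasDerivAt (fun x' => ux x' t) (uxx x t) x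
  hut : ∀ (x : ℝ), ∀ t ∈ Set.Ico (0:ℝ) T,
    HasDerivWithinAt (fun t' => u x t') (ut x t) (Set.Ico (0:ℝ) T) t
  hutx : ∀ (x : ℝ), ∀ t ∈ Set.Ico (0:ℝ) T,
    HasDerivWithinAt (fun t' => ux x t') (utx x t) (Set.Ico (0:ℝ) T) t
  contu : ContinuousOn (fun p : ℝ × ℝ => u p.1 p.2) (Set.univ ×ˢ Set.Ico (0:ℝ) T)
  contux : ContinuousOn (fun p : ℝ × ℝ => ux p.1 p.2) (Set.univ ×ˢ Set.Ico (0:ℝ) T)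
  contuxx : ContinuousOn (fun p : ℝ × ℝ => uxx p.1 p.2) (Set.univ ×ˢ Set.Ico (0:ℝ) T)
  contut : ContinuousOn (fun p : ℝ × ℝ => ut p.1 p.2) (Set.univ ×ˢ Set.Ico (0:ℝ) T)
  contutx : ContinuousOn (fun p : ℝ × ℝ => utx p.1 p.2) (Set.univ ×ˢ Set.Ico (0:ℝ) T)
  eqn : ∀ (x : ℝ), ∀ t ∈ Set.Ico (0:ℝ) T,
    ut x t - ux x t - (7/2) * ε * u x t * ux x t
      + deriv (pconv μ (gfun ε μ (fun x' => u x' t) (fun x' => ux x' t))) x = 0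

/-- `n₂ = ‖P‖_{L²[0,1]}`. -/
noncomputable def n2 (μ : ℝ) : ℝ := Real.sqrt (∫ x in (0:ℝ)..1, (P μ x)^2)

/-- `n_∞ = ‖P‖_{L^∞[0,1]}`. -/
noncomputable def ninf (μ : ℝ) : ℝ := sSup ((fun x => |P μ x|) '' Set.Icc (0:ℝ) 1)

/-- The constant `K₁` appearing in the differential inequalities for the maximal slope. -/
noncomputable def K1 (ε μ C₀ : ℝ) : ℝ :=
  (2 * n2 μ * Real.sqrt C₀ + (5/2) * ε * ninf μ * C₀
    + (1/8) * ε^2 * ninf μ * Real.sqrt (13/μ) * (C₀ * Real.sqrt C₀)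
    + (3/64) * ε^3 * ninf μ * (13/μ) * C₀^2
    + (7/4) * ε * ninf μ * C₀)
  + (2 * Real.sqrt (13/μ) * Real.sqrt C₀ + (5/2) * ε * (13/μ) * C₀
    + (1/8) * ε^2 * ((13/μ) * Real.sqrt (13/μ)) * (C₀ * Real.sqrt C₀)
    + (3/64) * ε^3 * (13/μ)^2 * C₀^2)

theorem P_eq_comp_fract (μ : ℝ) : P μ = (fun y => Real.sqrt (3/μ) *
    (Real.exp (2 * Real.sqrt (3/μ) * y) + Real.exp (2 * Real.sqrt (3/μ) * (1 - y))) /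
    (Real.exp (2 * Real.sqrt (3/μ)) - 1)) ∘ Int.fract := rfl

theorem continuous_P (μ : ℝ) : Continuous (P μ) := by
  rw [P_eq_comp_fract]
  refine ContinuousOn.comp_fract'' (Continuous.continuousOn (by fun_prop)) ?_
  simp [add_comm]

theorem periodic_P (μ : ℝ) : Function.Periodic (P μ) 1 := by
  intro x
  simp only [P_eq_comp_fract, Function.comp, Int.fract_add_one]

theorem P_of_mem_Ico (μ : ℝ) {x : ℝ} (hx : x ∈ Set.Ico (0:ℝ) 1) :
    P μ x = Real.sqrt (3/μ) *
      (Real.exp (2 * Real.sqrt (3/μ) * x) + Real.exp (2 * Real.sqrt (3/μ) * (1 - x))) /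
      (Real.exp (2 * Real.sqrt (3/μ)) - 1) := by
  simp only [P_eq_comp_fract, Function.comp, Int.fract_eq_self.2 hx]

theorem abs_P_le_ninf (μ x : ℝ) : |P μ x| ≤ ninf μ := by
  have hx : P μ x = P μ (Int.fract x) := by
    simp only [P_eq_comp_fract, Function.comp, Int.fract_fract]
  rw [hx]
  refine le_csSup ?_ ⟨Int.fract x, ⟨Int.fract_nonneg x, (Int.fract_lt_one x).le⟩, rfl⟩
  exact (isCompact_Icc.image (continuous_P μ).abs).bddAbove

theorem ninf_nonneg (μ : ℝ) : 0 ≤ ninf μ := (abs_nonneg _).trans (abs_P_le_ninf μ 0)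

/-- Cauchy-Schwarz for continuous functions on the unit interval. -/
theorem sq_integral_mul_le {f g : ℝ → ℝ} (hf : Continuous f) (hg : Continuous g) :
    (∫ y in (0:ℝ)..1, f y * g y) ^ 2 ≤ (∫ y in (0:ℝ)..1, f y ^ 2) * ∫ y in (0:ℝ)..1, g y ^ 2 := by
  have key : ∀ c : ℝ, 0 ≤ (∫ y in (0:ℝ)..1, f y ^ 2) * (c * c)
      + (2 * ∫ y in (0:ℝ)..1, f y * g y) * c + ∫ y in (0:ℝ)..1, g y ^ 2 := by
    intro c
    have h0 : 0 ≤ ∫ y in (0:ℝ)..1, (c * f y + g y) ^ 2 :=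
      intervalIntegral.integral_nonneg zero_le_one fun y _ => sq_nonneg _
    have h1 : ∫ y in (0:ℝ)..1, (c * f y + g y) ^ 2
        = ∫ y in (0:ℝ)..1, ((c * c) * f y ^ 2 + (2 * c) * (f y * g y) + g y ^ 2) := by
      congr 1; ext y; ring
    rw [h1, intervalIntegral.integral_add, intervalIntegral.integral_add,
      intervalIntegral.integral_const_mul, intervalIntegral.integral_const_mul] at h0
    · linarith
    all_goals exact Continuous.intervalIntegrable (by fun_prop) _ _
  have := discrim_le_zero key
  unfold discrim at this
  linarith

theorem pconv_eq (μ : ℝ) {h : ℝ → ℝ} (hc : Continuous h) (hp : Function.Periodic h 1) (x : ℝ) :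
    pconv μ h x = Real.sqrt (3/μ) / (Real.exp (2 * Real.sqrt (3/μ)) - 1) *
      (Real.exp (2 * Real.sqrt (3/μ) * x) *
          (∫ y in (x-1)..x, Real.exp (-(2 * Real.sqrt (3/μ) * y)) * h y)
        + Real.exp (2 * Real.sqrt (3/μ) * (1 - x)) *
          ∫ y in (x-1)..x, Real.exp (2 * Real.sqrt (3/μ) * y) * h y) := by
  have hper : Function.Periodic (fun y => P μ (x - y) * h y) 1 := by
    intro y
    simp only [hp y]
    rw [← periodic_P μ (x - (y + 1))]
    congr 2; ring
  have h1 : pconv μ h x = ∫ y in (x-1)..x, P μ (x - y) * h y := by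
    have := hper.intervalIntegral_add_eq 0 (x-1)
    simpa [pconv] using this
  rw [h1, ← intervalIntegral.integral_const_mul, ← intervalIntegral.integral_const_mul,
    ← intervalIntegral.integral_add, ← intervalIntegral.integral_const_mul]
  · refine intervalIntegral.integral_congr_ae (Filter.Eventually.of_forall fun y hy => ?_)
    rw [Set.uIoc_of_le (by linarith)] at hy
    rw [P_of_mem_Ico μ ⟨by linarith [hy.2], by linarith [hy.1]⟩]
    have e1 : Real.exp (2 * Real.sqrt (3/μ) * (x - y))
        = Real.exp (2 * Real.sqrt (3/μ) * x) * Real.exp (-(2 * Real.sqrt (3/μ) * y)) := by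
      rw [← Real.exp_add]; congr 1; ring
    have e2 : Real.exp (2 * Real.sqrt (3/μ) * (1 - (x - y)))
        = Real.exp (2 * Real.sqrt (3/μ) * (1 - x)) * Real.exp (2 * Real.sqrt (3/μ) * y) := by
      rw [← Real.exp_add]; congr 1; ring
    rw [e1, e2]
    ring
  all_goals exact Continuous.intervalIntegrable (by fun_prop) _ _

theorem hasDerivAt_integral_unit_window {f : ℝ → ℝ} (hf : Continuous f) (x : ℝ) :
    HasDerivAt (fun z => ∫ y in (z-1)..z, f y) (f x - f (x - 1)) x := by
  have h1 : ∀ z, HasDerivAt (fun z => ∫ y in (0:ℝ)..z, f y) (f z) z := fun z =>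
    intervalIntegral.integral_hasDerivAt_right (hf.intervalIntegrable _ _)
      hf.stronglyMeasurable.stronglyMeasurableAtFilter hf.continuousAt
  have h2 := (h1 x).sub ((h1 (x - 1)).comp_sub_const x 1)
  refine h2.congr_of_eventuallyEq (Filter.Eventually.of_forall fun z => ?_)
  simp only [Pi.sub_apply]
  rw [intervalIntegral.integral_interval_sub_left] <;> exact hf.intervalIntegrable _ _

/-- `P ∗ h` is twice differentiable and solves `(1 - (μ/12)∂ₓ²) v = h`. -/
theorem exists_hasDerivAt_pconv {μ : ℝ} (hμ : 0 < μ) {h : ℝ → ℝ} (hc : Continuous h)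
    (hp : Function.Periodic h 1) :
    ∃ Q : ℝ → ℝ, (∀ x, HasDerivAt (pconv μ h) (Q x) x) ∧
      ∀ x, HasDerivAt Q ((12/μ) * (pconv μ h x - h x)) x := by
  set a := Real.sqrt (3/μ) with ha
  have ha0 : 0 < a := Real.sqrt_pos.2 (by positivity)
  have ha2 : a ^ 2 = 3 / μ := Real.sq_sqrt (by positivity)
  have hE : Real.exp (2 * a) - 1 ≠ 0 := by
    have : 1 < Real.exp (2 * a) := Real.one_lt_exp_iff.2 (by positivity)
    linarith
  have hpc := pconv_eq μ hc hp
  rw [← ha] at hpc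
  set I := fun x => ∫ y in (x-1)..x, Real.exp (-(2 * a * y)) * h y with hI
  set J := fun x => ∫ y in (x-1)..x, Real.exp (2 * a * y) * h y with hJ
  have hpm : ∀ x, h (x - 1) = h x := fun x => hp.sub_eq x
  have dI : ∀ x, HasDerivAt I (Real.exp (-(2 * a * x)) * h x * (1 - Real.exp (2 * a))) x := by
    intro x
    convert hasDerivAt_integral_unit_window
      (f := fun y => Real.exp (-(2 * a * y)) * h y) (by fun_prop) x using 1
    rw [hpm, show -(2 * a * (x - 1)) = -(2 * a * x) + 2 * a by ring, Real.exp_add]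
    ring
  have dJ : ∀ x, HasDerivAt J (Real.exp (2 * a * x) * h x * (1 - Real.exp (-(2 * a)))) x := by
    intro x
    convert hasDerivAt_integral_unit_window
      (f := fun y => Real.exp (2 * a * y) * h y) (by fun_prop) x using 1
    rw [hpm, show 2 * a * (x - 1) = 2 * a * x + -(2 * a) by ring, Real.exp_add]
    ring
  have dE : ∀ x, HasDerivAt (fun x => Real.exp (2 * a * x)) (Real.exp (2 * a * x) * (2 * a)) x := by
    intro x
    simpa using ((hasDerivAt_id x).const_mul (2 * a)).exp
  have dF : ∀ x, HasDerivAt (fun x => Real.exp (2 * a * (1 - x)))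
      (Real.exp (2 * a * (1 - x)) * (-(2 * a))) x := by
    intro x
    simpa using (((hasDerivAt_id x).const_sub 1).const_mul (2 * a)).exp
  have eI : ∀ x, Real.exp (2 * a * x) * Real.exp (-(2 * a * x)) = 1 := by
    intro x; rw [← Real.exp_add]; simp
  have eJ : ∀ x, Real.exp (2 * a * (1 - x)) * Real.exp (2 * a * x) = Real.exp (2 * a) := by
    intro x; rw [← Real.exp_add]; congr 1; ring
  have e0 : Real.exp (2 * a) * Real.exp (-(2 * a)) = 1 := by
    rw [← Real.exp_add]; simp
  refine ⟨fun x => a / (Real.exp (2 * a) - 1) * (2 * a) *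
    (Real.exp (2 * a * x) * I x - Real.exp (2 * a * (1 - x)) * J x), fun x => ?_, fun x => ?_⟩
  · have := (((dE x).mul (dI x)).add ((dF x).mul (dJ x))).const_mul (a / (Real.exp (2 * a) - 1))
    rw [show pconv μ h = _ from funext hpc]
    refine this.congr_deriv ?_
    linear_combination (a / (Real.exp (2 * a) - 1)) * (h x * (1 - Real.exp (2 * a)) * eI x
      + h x * (1 - Real.exp (-(2 * a))) * eJ x - h x * e0)
  · have := (((dE x).mul (dI x)).sub ((dF x).mul (dJ x))).const_mul
      (a / (Real.exp (2 * a) - 1) * (2 * a))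
    refine this.congr_deriv ?_
    have h12 : 12 / μ = 4 * a ^ 2 := by rw [ha2]; ring
    have hh : a / (Real.exp (2 * a) - 1) * (2 * a) * (h x * (1 - Real.exp (2 * a)))
        = -(2 * a ^ 2 * h x) := by
      have : a / (Real.exp (2 * a) - 1) * (1 - Real.exp (2 * a)) = -a := by
        rw [div_mul_eq_mul_div, div_eq_iff hE]; ring
      linear_combination 2 * a * h x * this
    rw [hpc, h12]
    linear_combination (a / (Real.exp (2 * a) - 1) * (2 * a)) *
      (h x * (1 - Real.exp (2 * a)) * eI x
      - h x * (1 - Real.exp (-(2 * a))) * eJ x + h x * e0) + 2 * hh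

/-- Sobolev bound `‖v‖²_∞ ≤ (13/μ) ∫ (v² + (μ/12) v_x²)` for 1-periodic functions. -/
theorem sq_le_energy {μ : ℝ} (hμ : 0 < μ) (hμ' : μ ≤ 12) {v w : ℝ → ℝ}
    (hv : ∀ x, HasDerivAt v (w x) x) (hw : Continuous w) (hp : Function.Periodic v 1)
    (hpw : Function.Periodic w 1) (x : ℝ) :
    v x ^ 2 ≤ (13/μ) * ∫ y in (0:ℝ)..1, (v y ^ 2 + (μ/12) * w y ^ 2) := by
  have hcv : Continuous v := continuous_iff_continuousAt.2 fun x => (hv x).continuousAt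
  set C := ∫ y in (0:ℝ)..1, (v y ^ 2 + (μ/12) * w y ^ 2) with hC
  have hC0 : 0 ≤ C := intervalIntegral.integral_nonneg zero_le_one fun y _ => by positivity
  have hrep : ∫ s in (0:ℝ)..1, (v (x + s) + (s - 1/2) * w (x + s)) = v x := by
    have hd : ∀ s, HasDerivAt (fun s => (s - 1/2) * v (x + s))
        (v (x + s) + (s - 1/2) * w (x + s)) s := by
      intro s
      have := ((hasDerivAt_id s).sub_const (1/2)).mul ((hv (x + s)).comp_const_add x s)
      exact this.congr_deriv (by simp)
    rw [intervalIntegral.integral_eq_sub_of_hasDerivAt (fun s _ => hd s)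
      (Continuous.intervalIntegrable (by fun_prop) _ _), hp x]
    norm_num
    ring
  have hshift : ∫ s in (0:ℝ)..1, (v (x + s) ^ 2 + (μ/12) * w (x + s) ^ 2) = C := by
    have hper : Function.Periodic (fun y => v y ^ 2 + (μ/12) * w y ^ 2) 1 := fun y => by
      simp only [hp y, hpw y]
    have h1 := hper.intervalIntegral_add_eq x 0
    rw [intervalIntegral.integral_comp_add_left (fun y => v y ^ 2 + (μ/12) * w y ^ 2) x]
    simpa [hC] using h1
  set θ := 1 + 1/μ with hθ
  have hθ0 : 0 < θ := by positivity
  have hquad : ∫ s in (0:ℝ)..1, (1 + (12/μ) * (s - 1/2)^2) = θ := by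
    have hd : ∀ s : ℝ, HasDerivAt (fun s : ℝ => s + (4/μ) * (s - 1/2)^3)
        (1 + (12/μ) * (s - 1/2)^2) s := by
      intro s
      have := (hasDerivAt_id s).add ((((hasDerivAt_id s).sub_const (1/2)).pow 3).const_mul (4/μ))
      refine this.congr_deriv ?_
      simp only [id]
      push_cast
      ring
    rw [intervalIntegral.integral_eq_sub_of_hasDerivAt (fun s _ => hd s)
      (Continuous.intervalIntegrable (by fun_prop) _ _), hθ]
    norm_num
    ring
  have hmono : ∫ s in (0:ℝ)..1, (2 * v x * θ) * (v (x + s) + (s - 1/2) * w (x + s))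
      ≤ ∫ s in (0:ℝ)..1, (θ^2 * (v (x + s) ^ 2 + (μ/12) * w (x + s) ^ 2)
        + v x ^ 2 * (1 + (12/μ) * (s - 1/2)^2)) := by
    refine intervalIntegral.integral_mono_on zero_le_one
      (Continuous.intervalIntegrable (by fun_prop) _ _)
      (Continuous.intervalIntegrable (by fun_prop) _ _) fun s _ => ?_
    have h1 := sq_nonneg (θ * v (x + s) - v x)
    have h2 : 0 ≤ (12/μ) * ((μ/12) * θ * w (x + s) - v x * (s - 1/2))^2 := by positivity
    have h3 : (12/μ) * ((μ/12) * θ * w (x + s) - v x * (s - 1/2))^2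
        = θ^2 * ((μ/12) * w (x + s) ^ 2) - 2 * v x * θ * ((s - 1/2) * w (x + s))
          + v x ^ 2 * ((12/μ) * (s - 1/2)^2) := by
      field_simp
      ring
    rw [h3] at h2
    linarith
  rw [intervalIntegral.integral_const_mul, hrep, intervalIntegral.integral_add
    (Continuous.intervalIntegrable (by fun_prop) _ _)
    (Continuous.intervalIntegrable (by fun_prop) _ _), intervalIntegral.integral_const_mul,
    intervalIntegral.integral_const_mul, hshift, hquad] at hmono
  have h4 : v x ^ 2 ≤ θ * C := by
    refine le_of_mul_le_mul_left ?_ hθ0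
    linarith
  have h5 : θ ≤ 13 / μ := by
    rw [hθ, le_div_iff₀ hμ]
    field_simp
    linarith
  exact h4.trans (mul_le_mul_of_nonneg_right h5 hC0)

theorem abs_pconv_le_n2 (μ : ℝ) {h : ℝ → ℝ} (hc : Continuous h) (x : ℝ) :
    |pconv μ h x| ≤ n2 μ * Real.sqrt (∫ y in (0:ℝ)..1, h y ^ 2) := by
  have hP : Continuous fun y => P μ (x - y) := (continuous_P μ).comp (by fun_prop)
  have h1 := sq_integral_mul_le hP hc
  have h2 : ∫ y in (0:ℝ)..1, P μ (x - y) ^ 2 = ∫ y in (0:ℝ)..1, P μ y ^ 2 := by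
    rw [intervalIntegral.integral_comp_sub_left (fun y => P μ y ^ 2) x]
    have hper : Function.Periodic (fun y => P μ y ^ 2) 1 := fun y => by
      simp only [periodic_P μ y]
    have := hper.intervalIntegral_add_eq (x - 1) 0
    simpa using this
  rw [h2] at h1
  rw [n2, ← Real.sqrt_mul
    (intervalIntegral.integral_nonneg zero_le_one fun y _ => sq_nonneg _)]
  exact Real.abs_le_sqrt h1

theorem abs_pconv_le_ninf (μ : ℝ) {h k : ℝ → ℝ} (hc : Continuous h) (hk : Continuous k)
    (hle : ∀ y, |h y| ≤ k y) (x : ℝ) :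
    |pconv μ h x| ≤ ninf μ * ∫ y in (0:ℝ)..1, k y := by
  have hP : Continuous fun y => P μ (x - y) := (continuous_P μ).comp (by fun_prop)
  rw [← intervalIntegral.integral_const_mul]
  refine (intervalIntegral.abs_integral_le_integral_abs zero_le_one).trans
    (intervalIntegral.integral_mono_on zero_le_one
      (Continuous.intervalIntegrable (by fun_prop) _ _)
      (Continuous.intervalIntegrable (by fun_prop) _ _) fun y _ => ?_)
  rw [abs_mul]
  exact mul_le_mul (abs_P_le_ninf μ _) (hle y) (abs_nonneg _) (ninf_nonneg μ)

theorem pconv_add (μ : ℝ) {h k : ℝ → ℝ} (hc : Continuous h) (hk : Continuous k) (x : ℝ) :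
    pconv μ (fun y => h y + k y) x = pconv μ h x + pconv μ k x := by
  have hP : Continuous fun y => P μ (x - y) := (continuous_P μ).comp (by fun_prop)
  unfold pconv
  rw [← intervalIntegral.integral_add (Continuous.intervalIntegrable (by fun_prop) _ _)
    (Continuous.intervalIntegrable (by fun_prop) _ _)]
  simp only [mul_add]

theorem pconv_const_mul (μ c : ℝ) (h : ℝ → ℝ) (x : ℝ) :
    pconv μ (fun y => c * h y) x = c * pconv μ h x := by
  unfold pconv
  rw [← intervalIntegral.integral_const_mul]
  congr 1; ext y; ring

/-- The nonlocal term and the non-quadratic-in-slope part of `g` are bounded by `K₁`. -/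
theorem pconv_gfun_sub_le_K1 {ε μ : ℝ} (hε : 0 < ε) (hμ : 0 < μ) (hμ' : μ ≤ 12) {v w : ℝ → ℝ}
    (hv : ∀ x, HasDerivAt v (w x) x) (hw : Continuous w) (hp : Function.Periodic v 1)
    (hpw : Function.Periodic w 1) {C : ℝ}
    (hC : ∫ y in (0:ℝ)..1, (v y ^ 2 + (μ/12) * w y ^ 2) = C) (x : ℝ) :
    pconv μ (gfun ε μ v w) x - gfun ε μ v w x ≤ K1 ε μ C + (7/48) * ε * μ * w x ^ 2 := by
  have hcv : Continuous v := continuous_iff_continuousAt.2 fun x => (hv x).continuousAt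
  have hC0 : 0 ≤ C := by
    rw [← hC]
    exact intervalIntegral.integral_nonneg zero_le_one fun y _ => by positivity
  have hsup := sq_le_energy hμ hμ' hv hw hp hpw
  rw [hC] at hsup
  set s := Real.sqrt (13/μ) with hs
  set r := Real.sqrt C with hr
  have hs0 : 0 ≤ s := Real.sqrt_nonneg _
  have hr0 : 0 ≤ r := Real.sqrt_nonneg _
  have hs2 : s ^ 2 = 13/μ := Real.sq_sqrt (by positivity)
  have hr2 : r ^ 2 = C := Real.sq_sqrt hC0
  have habs : ∀ y, |v y| ≤ s * r := fun y => by
    refine abs_le_of_sq_le_sq ?_ (by positivity)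
    rw [mul_pow, hs2, hr2]
    exact hsup y
  have hcube : ∀ y, |v y ^ 3| ≤ s * r * v y ^ 2 := fun y => by
    rw [abs_pow, pow_succ', sq_abs]
    exact mul_le_mul_of_nonneg_right (habs y) (sq_nonneg _)
  have hquart : ∀ y, v y ^ 4 ≤ (s * r) ^ 2 * v y ^ 2 := fun y => by
    have : v y ^ 2 ≤ (s * r) ^ 2 := by rw [← sq_abs]; gcongr; exact habs y
    nlinarith [mul_le_mul_of_nonneg_right this (sq_nonneg (v y))]
  set c := (5/2) * ε + (1/8) * ε^2 * (s * r) + (3/64) * ε^3 * (s * r)^2 with hc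
  have hc0 : 0 ≤ c := by positivity
  set ρ : ℝ → ℝ := fun y => (5/2) * ε * (v y)^2 - (1/8) * ε^2 * (v y)^3
    + (3/64) * ε^3 * (v y)^4 - (7/48) * ε * μ * (w y)^2 with hρ
  have hcρ : Continuous ρ := by fun_prop
  have hρle : ∀ y, |ρ y| ≤ (c + (7/4) * ε) * (v y ^ 2 + (μ/12) * w y ^ 2) := fun y => by
    have h3 := abs_le.1 (hcube y)
    have hε2 : 0 ≤ (1/8) * ε^2 := by positivity
    have hε3 : 0 ≤ (3/64) * ε^3 := by positivity
    have a1 := mul_le_mul_of_nonneg_left h3.1 hε2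
    have a2 := mul_le_mul_of_nonneg_left h3.2 hε2
    have a3 := mul_le_mul_of_nonneg_left (hquart y) hε3
    have a4 : 0 ≤ (3/64) * ε^3 * v y ^ 4 := by positivity
    have a5 : 0 ≤ c * ((μ/12) * w y ^ 2) := by positivity
    have a6 : 0 ≤ ε * v y ^ 2 := by positivity
    have a7 : 0 ≤ (7/48) * ε * μ * (w y)^2 := by positivity
    have a8 : 0 ≤ (3/64) * ε^3 * (s * r)^2 * v y ^ 2 := by positivity
    have a9 : 0 ≤ (1/8) * ε^2 * (s * r) * v y ^ 2 := by positivity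
    have e : (c + (7/4) * ε) * (v y ^ 2 + (μ/12) * w y ^ 2)
      = (5/2) * ε * v y ^ 2 + (1/8) * ε^2 * (s * r) * v y ^ 2
        + (3/64) * ε^3 * (s * r)^2 * v y ^ 2
        + c * ((μ/12) * w y ^ 2) + (7/4) * (ε * v y ^ 2) + (7/48) * ε * μ * (w y)^2 := by
      rw [hc]; ring
    rw [e, abs_le]
    simp only [hρ]
    constructor <;> linarith
  have hg : gfun ε μ v w = fun y => 2 * v y + ρ y := by
    ext y; simp only [gfun, hρ]; ring
  have b1 := abs_le.1 (abs_pconv_le_ninf μ hcρ (by fun_prop) hρle x)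
  rw [intervalIntegral.integral_const_mul, hC] at b1
  have b2 := abs_le.1 (abs_pconv_le_n2 μ hcv x)
  have b3 : Real.sqrt (∫ y in (0:ℝ)..1, v y ^ 2) ≤ r := by
    refine Real.sqrt_le_sqrt ?_
    rw [← hC]
    refine intervalIntegral.integral_mono_on zero_le_one
      (Continuous.intervalIntegrable (by fun_prop) _ _)
      (Continuous.intervalIntegrable (by fun_prop) _ _) fun y _ => ?_
    have : 0 ≤ (μ/12) * w y ^ 2 := by positivity
    linarith
  have hn2 : 0 ≤ n2 μ := Real.sqrt_nonneg _
  have b4 := mul_le_mul_of_nonneg_left b3 hn2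
  have hρx : ρ x = (5/2) * ε * (v x)^2 - (1/8) * ε^2 * (v x)^3
    + (3/64) * ε^3 * (v x)^4 - (7/48) * ε * μ * (w x)^2 := rfl
  have hu := abs_le.1 (habs x)
  have hu2 : 0 ≤ (5/2) * ε * v x ^ 2 := by positivity
  have hu3 : (1/8) * ε^2 * v x ^ 3 ≤ (1/8) * ε^2 * (s * r)^3 := by
    refine mul_le_mul_of_nonneg_left ?_ (by positivity)
    calc v x ^ 3 ≤ |v x| ^ 3 := by rw [← abs_pow]; exact le_abs_self _
      _ ≤ (s * r) ^ 3 := by gcongr; exact habs x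
  have hu4 : 0 ≤ (3/64) * ε^3 * v x ^ 4 := by positivity
  have hk2 : 0 ≤ (5/2) * ε * (s^2 * r^2) := by positivity
  have hk4 : 0 ≤ (3/64) * ε^3 * (s^4 * r^4) := by positivity
  have hK : K1 ε μ C = 2 * (n2 μ * r) + ninf μ * ((c + (7/4) * ε) * C)
      + (2 * (s * r) + (5/2) * ε * (s^2 * r^2) + (1/8) * ε^2 * (s * r)^3
        + (3/64) * ε^3 * (s^4 * r^4)) := by
    rw [K1, ← hs, ← hr, ← hs2, hc, ← hr2]
    ring
  rw [hg, pconv_add μ (by fun_prop) hcρ, pconv_const_mul, hK]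
  linarith [b1.2, b2.2, hu.1]

theorem K1_pos {ε μ C : ℝ} (hε : 0 < ε) (hμ : 0 < μ) (hC : 0 < C) : 0 < K1 ε μ C := by
  have h2 : 0 ≤ n2 μ := Real.sqrt_nonneg _
  have hi := ninf_nonneg μ
  unfold K1
  positivity

theorem tendsto_slope_of_hasDerivWithinAt_Ico {f : ℝ → ℝ} {f' t T : ℝ}
    (ht : t ∈ Set.Ico (0:ℝ) T) (hf : HasDerivWithinAt f f' (Set.Ico (0:ℝ) T) t) :
    Filter.Tendsto (slope f t) (nhdsWithin t (Set.Ioi t)) (nhds f') := by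
  have h1 : HasDerivWithinAt f f' (Set.Ioo t T) t :=
    hf.mono fun y hy => ⟨ht.1.trans hy.1.le, hy.2⟩
  rwa [hasDerivWithinAt_iff_tendsto_slope' (by simp), nhdsWithin_Ioo_eq_nhdsGT ht.2] at h1

namespace QLSol

variable {ε μ T : ℝ} (sol : QLSol ε μ T)

/-- The mixed partial derivatives of a classical solution agree. -/
theorem hasDerivAt_ut (x : ℝ) {t : ℝ} (ht : t ∈ Set.Ico (0:ℝ) T) :
    HasDerivAt (fun x' => sol.ut x' t) (sol.utx x t) x := by
  refine hasDerivAt_of_tendstoUniformlyOnFilter (l := nhdsWithin t (Set.Ioi t))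
    (f := fun τ s => slope (fun t' => sol.u s t') t τ)
    (f' := fun τ s => slope (fun t' => sol.ux s t') t τ) (g' := fun s => sol.utx s t) ?_ ?_ ?_
  · rw [Metric.tendstoUniformlyOnFilter_iff]
    intro η hη
    obtain ⟨δ, hδ, hcont⟩ := Metric.continuousOn_iff.1 sol.contutx (x, t) ⟨trivial, ht⟩
      (η / 2) (by linarith)
    have e1 : ∀ᶠ τ in nhdsWithin t (Set.Ioi t), τ ∈ Set.Ioo t (min T (t + δ)) :=
      Ioo_mem_nhdsGT (lt_min ht.2 (by linarith))
    have e2 : ∀ᶠ s in nhds x, s ∈ Metric.ball x δ := Metric.ball_mem_nhds x hδ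
    filter_upwards [e1.prod_mk e2]
    rintro ⟨τ, s⟩ ⟨hτ, hs⟩
    simp only at hτ hs ⊢
    have hτT : τ < T := hτ.2.trans_le (min_le_left _ _)
    have hτδ : τ < t + δ := hτ.2.trans_le (min_le_right _ _)
    have hsub : Set.Icc t τ ⊆ Set.Ico 0 T := fun y hy => ⟨ht.1.trans hy.1, hy.2.trans_lt hτT⟩
    obtain ⟨c, hc, hslope⟩ := exists_hasDerivAt_eq_slope (fun t' => sol.ux s t')
      (fun t' => sol.utx s t') hτ.1
      (fun y hy => ((sol.hutx s y (hsub hy)).continuousWithinAt).mono hsub)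
      (fun y hy => (sol.hutx s y (hsub ⟨hy.1.le, hy.2.le⟩)).hasDerivAt
        (Ico_mem_nhds (ht.1.trans_lt hy.1) (hy.2.trans hτT)))
    rw [slope_def_field, ← hslope]
    have d1 := hcont (s, c) ⟨trivial, hsub ⟨hc.1.le, hc.2.le⟩⟩ (by
      rw [Prod.dist_eq]
      refine max_lt hs ?_
      rw [Real.dist_eq, abs_lt]
      constructor <;> linarith [hc.1, hc.2])
    have d2 := hcont (s, t) ⟨trivial, ht⟩ (by
      rw [Prod.dist_eq]
      exact max_lt hs (by simpa using hδ))
    calc dist (sol.utx s t) (sol.utx s c)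
        ≤ dist (sol.utx s t) (sol.utx x t) + dist (sol.utx s c) (sol.utx x t) :=
          dist_triangle_right _ _ _
      _ < η := by simp only at d1 d2; linarith
  · have e1 : ∀ᶠ τ in nhdsWithin t (Set.Ioi t), τ ∈ Set.Ioo t T := Ioo_mem_nhdsGT ht.2
    filter_upwards [e1.prod_inl (nhds x)]
    rintro ⟨τ, s⟩ hτ
    have hτ' : τ ∈ Set.Ico 0 T := ⟨ht.1.trans hτ.1.le, hτ.2⟩
    exact ((sol.hux s τ hτ').sub (sol.hux s t ht)).const_smul (τ - t)⁻¹
  · exact Filter.Eventually.of_forall fun s =>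
      tendsto_slope_of_hasDerivWithinAt_Ico ht (sol.hut s t ht)

theorem periodic_ux {t : ℝ} (ht : t ∈ Set.Ico (0:ℝ) T) :
    Function.Periodic (fun x => sol.ux x t) 1 := by
  intro x
  have h1 : HasDerivAt (fun x' => sol.u (x' + 1) t) (sol.ux (x + 1) t) x :=
    (sol.hux (x + 1) t ht).comp_add_const x 1
  rw [show (fun x' => sol.u (x' + 1) t) = fun x' => sol.u x' t from
    funext (sol.periodic t ht)] at h1
  exact h1.unique (sol.hux x t ht)

theorem continuous_ux {t : ℝ} (ht : t ∈ Set.Ico (0:ℝ) T) : Continuous fun x => sol.ux x t :=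
  continuous_iff_continuousAt.2 fun x => (sol.huxx x t ht).continuousAt

theorem continuous_u {t : ℝ} (ht : t ∈ Set.Ico (0:ℝ) T) : Continuous fun x => sol.u x t :=
  continuous_iff_continuousAt.2 fun x => (sol.hux x t ht).continuousAt

/-- The maximal slope `sup_{x ∈ [0,1]} u_x(x,t)`. -/
noncomputable def maxSlope (t : ℝ) : ℝ := sSup ((fun x => sol.ux x t) '' Set.Icc (0:ℝ) 1)

theorem ux_le_maxSlope {t : ℝ} (ht : t ∈ Set.Ico (0:ℝ) T) (x : ℝ) :
    sol.ux x t ≤ sol.maxSlope t := by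
  have hx : sol.ux (Int.fract x) t = sol.ux x t := by
    have h := (sol.periodic_ux ht).sub_zsmul_eq (x := x) ⌊x⌋
    simp only [zsmul_eq_mul, mul_one] at h
    exact h
  rw [← hx]
  exact le_csSup (isCompact_Icc.image (sol.continuous_ux ht)).bddAbove
    ⟨Int.fract x, ⟨Int.fract_nonneg x, (Int.fract_lt_one x).le⟩, rfl⟩

theorem exists_ux_eq_maxSlope {t : ℝ} (ht : t ∈ Set.Ico (0:ℝ) T) :
    ∃ ξ, sol.ux ξ t = sol.maxSlope t := by
  obtain ⟨ξ, _, h⟩ := (isCompact_Icc.image (sol.continuous_ux ht)).sSup_mem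
    ((Set.nonempty_Icc.2 zero_le_one).image _)
  exact ⟨ξ, h⟩

theorem continuousOn_maxSlope {b : ℝ} (hb : 0 ≤ b) (hbT : b < T) :
    ContinuousOn sol.maxSlope (Set.Icc 0 b) := by
  have hc : Continuous fun p : ℝ × ℝ => sol.ux p.2 (Set.projIcc 0 b hb p.1 : ℝ) := by
    refine sol.contux.comp_continuous
      (f := fun p : ℝ × ℝ => (p.2, (Set.projIcc 0 b hb p.1 : ℝ))) ?_ fun p => ?_
    · exact continuous_snd.prodMk
        (continuous_subtype_val.comp (continuous_projIcc.comp continuous_fst))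
    · have := (Set.projIcc 0 b hb p.1).2
      exact ⟨trivial, this.1, this.2.trans_lt hbT⟩
  have hs := (isCompact_Icc (a := (0:ℝ)) (b := 1)).continuous_sSup
    (f := fun t x => sol.ux x (Set.projIcc 0 b hb t : ℝ)) hc
  refine hs.continuousOn.congr fun t ht => ?_
  simp only [maxSlope, Set.projIcc_of_mem hb ht]

/-- Riccati-type inequality for the slope at a point of maximal slope. -/
theorem le_utx_of_ux_eq_maxSlope (hε : 0 < ε) (hμ : 0 < μ) (hμ' : μ ≤ 12) {C₀ t : ℝ}
    (ht : t ∈ Set.Ico (0:ℝ) T)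
    (hC : (∫ x in (0:ℝ)..1, ((sol.u x t)^2 + (μ/12) * (sol.ux x t)^2)) = C₀)
    {ξ : ℝ} (hξ : sol.ux ξ t = sol.maxSlope t) :
    (7/4) * ε * sol.maxSlope t ^ 2 - (12/μ) * K1 ε μ C₀ ≤ sol.utx ξ t := by
  have hcu := sol.continuous_u ht
  have hcux := sol.continuous_ux ht
  have hpu := sol.periodic t ht
  have hpux := sol.periodic_ux ht
  have hg : Continuous (gfun ε μ (fun x' => sol.u x' t) (fun x' => sol.ux x' t)) := by
    unfold gfun; fun_prop
  have hgp : Function.Periodic (gfun ε μ (fun x' => sol.u x' t) (fun x' => sol.ux x' t)) 1 := by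
    intro x
    have h1 : sol.u (x + 1) t = sol.u x t := hpu x
    have h2 : sol.ux (x + 1) t = sol.ux x t := hpux x
    simp only [gfun, h1, h2]
  obtain ⟨Q, hQ, hQ'⟩ := exists_hasDerivAt_pconv hμ hg hgp
  have hut : (fun x => sol.ut x t)
      = fun x => sol.ux x t + (7/2) * ε * (sol.u x t * sol.ux x t) - Q x := by
    ext x
    have := sol.eqn x t ht
    rw [(hQ x).deriv] at this
    linarith
  have hd := ((sol.huxx ξ t ht).add
    (((sol.hux ξ t ht).mul (sol.huxx ξ t ht)).const_mul ((7/2) * ε))).sub (hQ' ξ)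
  have hd' := sol.hasDerivAt_ut ξ ht
  rw [hut] at hd'
  have heq := hd'.unique hd
  have hxx : sol.uxx ξ t = 0 := by
    refine IsLocalMax.hasDerivAt_eq_zero (f := fun x => sol.ux x t) ?_ (sol.huxx ξ t ht)
    refine Filter.Eventually.of_forall fun x => ?_
    simp only [hξ]
    exact sol.ux_le_maxSlope ht x
  have hK := pconv_gfun_sub_le_K1 hε hμ hμ' (fun x => sol.hux x t ht) hcux hpu hpux hC ξ
  have hK' := mul_le_mul_of_nonneg_left hK (by positivity : 0 ≤ 12 / μ)
  have e : 12 / μ * (K1 ε μ C₀ + (7/48) * ε * μ * sol.ux ξ t ^ 2)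
      = 12 / μ * K1 ε μ C₀ + (7/4) * ε * sol.ux ξ t ^ 2 := by
    field_simp; ring
  simp only [hxx] at heq
  rw [e] at hK'
  rw [heq, ← hξ]
  linarith

theorem frequently_slope_neg_maxSlope_lt {t ξ r : ℝ} (ht : t ∈ Set.Ico (0:ℝ) T)
    (hξ : sol.ux ξ t = sol.maxSlope t) (hr : -sol.utx ξ t < r) :
    ∃ᶠ z in nhdsWithin t (Set.Ioi t), slope (fun t' => -sol.maxSlope t') t z < r := by
  have h1 := tendsto_slope_of_hasDerivWithinAt_Ico ht (sol.hutx ξ t ht)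
  have h2 : ∀ᶠ z in nhdsWithin t (Set.Ioi t), -r < slope (fun t' => sol.ux ξ t') t z :=
    h1.eventually (lt_mem_nhds (by linarith))
  have h3 : ∀ᶠ z in nhdsWithin t (Set.Ioi t), z ∈ Set.Ioo t T := Ioo_mem_nhdsGT ht.2
  refine (h2.and h3).frequently.mono ?_
  rintro z ⟨hz, hzT⟩
  have hzt : 0 < z - t := sub_pos.2 hzT.1
  have hle := sol.ux_le_maxSlope ⟨ht.1.trans hzT.1.le, hzT.2⟩ ξ
  rw [slope_def_field, lt_div_iff₀ hzt] at hz
  rw [slope_def_field, div_lt_iff₀ hzt, ← hξ]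
  linarith

theorem maxSlope_zero_nonneg (hT : 0 < T) : 0 ≤ sol.maxSlope 0 := by
  have h0 : (0:ℝ) ∈ Set.Ico (0:ℝ) T := ⟨le_rfl, hT⟩
  obtain ⟨c, _, hc⟩ := exists_hasDerivAt_eq_zero (f := fun x => sol.u x 0)
    (f' := fun x => sol.ux x 0) zero_lt_one (sol.continuous_u h0).continuousOn
    (by simpa using (sol.periodic 0 h0 0).symm) (fun x _ => sol.hux x 0 h0)
  exact hc.symm.trans_le (sol.ux_le_maxSlope h0 c)

end QLSol

/-- Wave breaking in finite time of order `O(1/ε)`: if the initial profile is nontrivial,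
the energy equals `C₀` for all `t`, and the initial maximal slope `S(0) = sup_{[0,1]} u₀'`
satisfies `ε S(0)² ≥ (12/μ) K₁`, then the maximal existence time satisfies
`T ≤ 4/(3ε S(0))`. -/
theorem stmt15 (ε μ T C₀ : ℝ) (hε : 0 < ε) (hμ : 0 < μ) (hμ' : μ ≤ 12) (hT : 0 < T)
    (sol : QLSol ε μ T)
    (hne : ∃ x : ℝ, sol.u x 0 ≠ 0)
    (hC : ∀ t ∈ Set.Ico (0:ℝ) T,
      (∫ x in (0:ℝ)..1, ((sol.u x t)^2 + (μ/12) * (sol.ux x t)^2)) = C₀)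
    (S0 : ℝ) (hS0 : S0 = sSup ((fun x => sol.ux x 0) '' Set.Icc (0:ℝ) 1))
    (hbig : ε * S0^2 ≥ (12/μ) * K1 ε μ C₀) :
    T ≤ 4 / (3 * ε * S0) := by
  change S0 = sol.maxSlope 0 at hS0
  have h0 : (0:ℝ) ∈ Set.Ico (0:ℝ) T := ⟨le_rfl, hT⟩
  have hC0 : 0 < C₀ := by
    obtain ⟨x, hx⟩ := hne
    have h1 := sq_le_energy hμ hμ' (fun x => sol.hux x 0 h0) (sol.continuous_ux h0)
      (sol.periodic 0 h0) (sol.periodic_ux h0) x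
    rw [hC 0 h0] at h1
    exact pos_of_mul_pos_right ((pow_pos (abs_pos.2 hx) 2).trans_le (by rwa [sq_abs]))
      (by positivity : 0 ≤ 13 / μ)
  have hS0pos : 0 < S0 := by
    have hK := K1_pos hε hμ hC0
    have h1 : 0 < ε * S0 ^ 2 := lt_of_lt_of_le (by positivity) hbig
    have h2 : S0 ≠ 0 := by rintro rfl; simp at h1
    exact lt_of_le_of_ne (hS0 ▸ sol.maxSlope_zero_nonneg hT) h2.symm
  by_contra! hlt
  obtain ⟨t₁, ht₁, ht₁T⟩ := exists_between hlt
  have ht₁0 : 0 < t₁ := lt_trans (by positivity) ht₁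
  have hrate : 1 < (3/4) * ε * (S0 * t₁) := by
    rw [div_lt_iff₀ (by positivity)] at ht₁
    linarith
  have hcont := sol.continuousOn_maxSlope ht₁0.le ht₁T
  obtain ⟨M, hM⟩ := (isCompact_Icc.image_of_continuousOn hcont).bddAbove
  have hM' : ∀ t ∈ Set.Icc 0 t₁, sol.maxSlope t ≤ M := fun t ht => hM ⟨t, ht, rfl⟩
  have hS0M : S0 ≤ M := hS0 ▸ hM' 0 ⟨le_rfl, ht₁0.le⟩
  set b := t₁ - S0 * t₁ / (M + S0) with hb
  have hfrac : 0 < S0 * t₁ / (M + S0) := by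
    have : 0 < M + S0 := by linarith
    positivity
  have hb0 : 0 ≤ b := by
    rw [hb, sub_nonneg, div_le_iff₀ (by linarith)]
    nlinarith
  have hbt : b < t₁ := by linarith
  have hξ : ∀ t, ∃ ξ, t ∈ Set.Ico (0:ℝ) T → sol.ux ξ t = sol.maxSlope t := by
    intro t
    by_cases ht : t ∈ Set.Ico (0:ℝ) T
    · obtain ⟨ξ, h⟩ := sol.exists_ux_eq_maxSlope ht
      exact ⟨ξ, fun _ => h⟩
    · exact ⟨0, fun h => absurd h ht⟩
  choose ξ hξ using hξ
  have hIco : ∀ t ∈ Set.Ico 0 b, t ∈ Set.Ico 0 T := fun t ht =>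
    ⟨ht.1, ht.2.trans (hbt.trans ht₁T)⟩
  have hB : ∀ t < t₁, HasDerivAt (fun t => -(S0 * t₁ / (t₁ - t)))
      (-(S0 * t₁ / (t₁ - t) ^ 2)) t := by
    intro t ht
    have hne : t₁ - t ≠ 0 := by linarith
    have := (((hasDerivAt_id t).const_sub t₁).inv hne).const_mul (-(S0 * t₁))
    refine (this.congr_of_eventuallyEq (Filter.Eventually.of_forall fun z => ?_)).congr_deriv ?_
    · simp [div_eq_mul_inv]
    · simp [div_eq_mul_inv]
  have hcmp := image_le_of_liminf_slope_right_lt_deriv_boundary' (a := 0) (b := b)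
    (f := fun t => -sol.maxSlope t) (f' := fun t => -sol.utx (ξ t) t)
    (B := fun t => -(S0 * t₁ / (t₁ - t))) (B' := fun t => -(S0 * t₁ / (t₁ - t) ^ 2))
    (hcont.mono (Set.Icc_subset_Icc_right hbt.le)).neg
    (fun t ht r hr => sol.frequently_slope_neg_maxSlope_lt (hIco t ht) (hξ t (hIco t ht)) hr)
    (by rw [sub_zero, mul_div_assoc, div_self ht₁0.ne', mul_one, hS0])
    (fun t ht => (hB t (ht.2.trans_lt hbt)).continuousAt.continuousWithinAt)
    (fun t ht => (hB t (ht.2.trans hbt)).hasDerivWithinAt)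
    (fun t ht heq => ?_)
  · have h1 := hcmp (Set.right_mem_Icc.2 hb0)
    have h2 : S0 * t₁ / (t₁ - b) = M + S0 := by
      rw [hb, sub_sub_cancel, div_div_cancel₀ (by positivity)]
    rw [h2] at h1
    linarith [hM' b ⟨hb0, hbt.le⟩]
  · have hric := sol.le_utx_of_ux_eq_maxSlope hε hμ hμ' (hIco t ht) (hC t (hIco t ht))
      (hξ t (hIco t ht))
    have hd : 0 < t₁ - t := by linarith [ht.2]
    have hm : sol.maxSlope t = S0 * t₁ / (t₁ - t) := neg_injective heq
    have hmS : S0 ≤ sol.maxSlope t := by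
      rw [hm, le_div_iff₀ hd]
      nlinarith [ht.1]
    have hmS2 : ε * S0 ^ 2 ≤ ε * sol.maxSlope t ^ 2 := by gcongr
    have h1 : S0 * t₁ / (t₁ - t) ^ 2 < (3/4) * ε * sol.maxSlope t ^ 2 := by
      have e : (3/4) * ε * sol.maxSlope t ^ 2
          = (3/4) * ε * (S0 * t₁) * (S0 * t₁ / (t₁ - t) ^ 2) := by
        rw [hm, div_pow]; ring
      rw [e]
      exact lt_mul_of_one_lt_left (by positivity) hrate
    linarith
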